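/- arXiv:0804.1932 — 2 statements merged into one kernel-verified Lean document; each statement's English description precedes it below -/
import Mathlib

section
/- Let H be a symmetric normalised n×n Hadamard matrix with n ≥ 2 that satisfies the group condition (GC) and has at least one entry −1 on its diagonal. Then there exist a permutation Σ of [n] with Σ(1) = 1 and a symmetric normalised (n/2)×(n/2) Hadamard matrix H′ satisfying (GC) such that H_{Σ,Σ} = H₂ ⊗ H′, where H₂ is the 2×2 matrix with rows (1,1) and (1,−1). -/
open Matrix

/-- An `n × n` Hadamard matrix: entries in `{-1, 1}` and `H * Hᵀ = n • I`. -/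
def IsHadamardMatrix {n : ℕ} (H : Matrix (Fin n) (Fin n) ℝ) : Prop :=
  (∀ i j, H i j = 1 ∨ H i j = -1) ∧ H * Hᵀ = (n : ℝ) • 1

/-- `G(M, i)`: the set of rows multiplied componentwise with row `i`, together
with their negations. -/
def rowGroup {n : ℕ} (M : Matrix (Fin n) (Fin n) ℝ) (i : Fin n) : Set (Fin n → ℝ) :=
  {v | ∃ j : Fin n, v = M j * M i ∨ v = -(M j * M i)}

/-- The group condition (GC): `G(H, i) = G(H, 1)` and `G(Hᵀ, i) = G(Hᵀ, 1)` for all `i`. -/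
def GroupCond {n : ℕ} (H : Matrix (Fin n) (Fin n) ℝ) : Prop :=
  (∀ i i₀ : Fin n, i₀.1 = 0 → rowGroup H i = rowGroup H i₀) ∧
  (∀ i i₀ : Fin n, i₀.1 = 0 → rowGroup Hᵀ i = rowGroup Hᵀ i₀)

/-- `H` is normalised: first row and first column consist entirely of `+1`s. -/
def Normalised {n : ℕ} (H : Matrix (Fin n) (Fin n) ℝ) : Prop :=
  ∀ i j : Fin n, (i.1 = 0 → H i j = 1) ∧ (j.1 = 0 → H i j = 1)

/-- Kronecker (tensor) product with explicit row-major indexing: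
`(B ⊗ C)_{(k-1)t+i, (ℓ-1)u+j} = B_{k,ℓ} C_{i,j}`. -/
def kron {r t : ℕ} (B : Matrix (Fin r) (Fin r) ℝ) (C : Matrix (Fin t) (Fin t) ℝ) :
    Matrix (Fin (r * t)) (Fin (r * t)) ℝ :=
  fun i j => B i.divNat j.divNat * C i.modNat j.modNat

/-- The 2 × 2 Hadamard matrix `H₂`. -/
def H2 : Matrix (Fin 2) (Fin 2) ℝ := !![1, 1; 1, -1]

/-- Distinct rows of a Hadamard matrix are orthogonal, so the row map is injective. -/
theorem IsHadamardMatrix.row_injective {n : ℕ} {H : Matrix (Fin n) (Fin n) ℝ}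
    (hH : IsHadamardMatrix H) {i j : Fin n} (h : ∀ c, H i c = H j c) : i = j := by
  by_contra hij
  have hii := congrFun (congrFun hH.2 i) i
  have hij' := congrFun (congrFun hH.2 i) j
  simp only [Matrix.mul_apply, Matrix.transpose_apply, Matrix.smul_apply, Matrix.one_apply_eq,
    Matrix.one_apply_ne hij, smul_eq_mul, mul_one, mul_zero] at hii hij'
  have hn : (n : ℝ) = 0 := by
    rw [← hii, ← hij']
    exact Finset.sum_congr rfl fun c _ => by rw [h c]
  have := i.pos
  rw [Nat.cast_eq_zero] at hn
  omega

/-- In a normalised matrix satisfying (GC), the componentwise product of two rows is a row. -/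
theorem GroupCond.exists_row_eq_mul {n : ℕ} {H : Matrix (Fin n) (Fin n) ℝ}
    (hGC : GroupCond H) (hnorm : Normalised H) (i j : Fin n) :
    ∃ k, ∀ c, H k c = H i c * H j c := by
  let z : Fin n := ⟨0, i.pos⟩
  have hmem : H i * H j ∈ rowGroup H z := by
    rw [← hGC.1 j z rfl]
    exact ⟨i, Or.inl rfl⟩
  obtain ⟨k, hk | hk⟩ := hmem
  · refine ⟨k, fun c => ?_⟩
    have := congrFun hk c
    simp only [Pi.mul_apply, (hnorm z c).1 rfl, mul_one] at this
    exact this.symm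
  · have := congrFun hk z
    simp only [Pi.mul_apply, Pi.neg_apply, (hnorm _ z).2 rfl] at this
    norm_num at this

/-- A symmetric normalised `±1` matrix whose rows are closed under componentwise products
satisfies (GC). -/
theorem groupCond_of_row_mul {n : ℕ} {H : Matrix (Fin n) (Fin n) ℝ}
    (hentry : ∀ i j, H i j = 1 ∨ H i j = -1) (hsymm : H.IsSymm) (hnorm : Normalised H)
    (hmul : ∀ i j, ∃ k, ∀ c, H k c = H i c * H j c) : GroupCond H := by
  have key : ∀ i i₀ : Fin n, i₀.1 = 0 → rowGroup H i = rowGroup H i₀ := by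
    intro i i₀ h₀
    have hone : H i₀ = 1 := funext fun c => (hnorm i₀ c).1 h₀
    have hsq : H i * H i = 1 := funext fun c => by
      rcases hentry i c with h | h <;> simp [h]
    ext v
    simp only [rowGroup, Set.mem_ofPred_eq, hone, mul_one]
    constructor <;> rintro ⟨j, hj⟩ <;> obtain ⟨k, hk⟩ := hmul j i
    · have hk' : H k = H j * H i := funext hk
      exact ⟨k, by rwa [hk']⟩
    · have hk' : H k = H j * H i := funext hk
      exact ⟨k, by rwa [hk', mul_assoc, hsq, mul_one]⟩
  exact ⟨key, by rwa [hsymm.eq]⟩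

theorem stmt5 {n : ℕ} (hn : 2 ≤ n) (H : Matrix (Fin n) (Fin n) ℝ)
    (hH : IsHadamardMatrix H) (hsymm : H.IsSymm) (hnorm : Normalised H)
    (hGC : GroupCond H) (hdiag : ∃ i : Fin n, H i i = -1) :
    ∃ (σ : Equiv.Perm (Fin n)) (m : ℕ) (hm : n = 2 * m)
      (H' : Matrix (Fin m) (Fin m) ℝ),
      σ ⟨0, by omega⟩ = ⟨0, by omega⟩ ∧
      IsHadamardMatrix H' ∧ H'.IsSymm ∧ Normalised H' ∧ GroupCond H' ∧
      ∀ i j : Fin n, H (σ i) (σ j) = kron H2 H' (Fin.cast hm i) (Fin.cast hm j) := by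
  obtain ⟨a, ha⟩ := hdiag
  have hs : ∀ i j, H i j = H j i := fun i j => hsymm.apply j i
  have hsq : ∀ i j, H i j * H i j = 1 := fun i j => by
    rcases hH.1 i j with h | h <;> simp [h]
  let z : Fin n := ⟨0, by omega⟩
  choose mul hmul using hGC.exists_row_eq_mul hnorm
  have hmul' : ∀ i j c, H c (mul i j) = H c i * H c j := fun i j c => by
    rw [hs, hmul, hs i, hs j]
  have htt : ∀ i, mul a (mul a i) = i := fun i => hH.row_injective fun c => by
    rw [hmul, hmul, ← mul_assoc, hsq, one_mul]
  let S : Finset (Fin n) := Finset.univ.filter fun i => H a i = 1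
  have hS : ∀ i, i ∈ S ↔ H a i = 1 := fun i => by simp [S]
  have hzS : z ∈ S := (hS z).2 ((hnorm a z).2 rfl)
  obtain ⟨m, hm⟩ : ∃ m, S.card = m := ⟨_, rfl⟩
  let e : Fin m ≃o S := S.orderIsoOfFin hm
  have heS : ∀ x, H a (e x) = 1 := fun x => (hS _).1 (e x).2
  have he0 : ∀ x : Fin m, x.1 = 0 → (e x : Fin n) = z := fun x hx => by
    have hle : e x ≤ ⟨z, hzS⟩ := by
      rw [← e.le_symm_apply, Fin.le_def, hx]
      exact Nat.zero_le _
    have hle' : (e x : Fin n) ≤ z := hle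
    exact Fin.ext (Nat.le_zero.1 hle')
  let f : Fin 2 × Fin m → Fin n := fun p => if p.1 = 0 then e p.2 else mul a (e p.2)
  have hf0 : ∀ x, f (0, x) = e x := fun x => rfl
  have hf1 : ∀ x, f (1, x) = mul a (e x) := fun x => rfl
  have hta : ∀ i, H a (mul a i) = -H a i := fun i => by rw [hmul', ha, neg_one_mul]
  have hfbij : Function.Bijective f := by
    constructor
    · rintro ⟨b, x⟩ ⟨b', y⟩ h
      have hinj : (e x : Fin n) = e y → x = y := fun h => e.injective (Subtype.ext h)
      have hne : ∀ x y, (e x : Fin n) ≠ mul a (e y) := fun x y h => by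
        have h1 := hta (e y)
        rw [← h, heS, heS] at h1
        norm_num at h1
      fin_cases b <;> fin_cases b' <;> simp only [Fin.zero_eta, Fin.mk_one, hf0, hf1] at h ⊢
      · rw [hinj h]
      · exact absurd h (hne _ _)
      · exact absurd h.symm (hne _ _)
      · rw [hinj (by rw [← htt (e x), h, htt])]
    · intro i
      rcases hH.1 a i with h | h
      · exact ⟨(0, e.symm ⟨i, (hS i).2 h⟩), by simp [hf0]⟩
      · have hi : mul a i ∈ S := (hS _).2 (by rw [hta, h, neg_neg])
        exact ⟨(1, e.symm ⟨_, hi⟩), by simp [hf1, htt]⟩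
  let F : Fin 2 × Fin m ≃ Fin n := Equiv.ofBijective f hfbij
  have hnm : n = 2 * m := by simpa using (Fintype.card_congr F).symm
  let H' : Matrix (Fin m) (Fin m) ℝ := fun x y => H (e x) (e y)
  have hsymm' : H'.IsSymm := Matrix.IsSymm.ext fun x y => hs _ _
  have hnorm' : Normalised H' := fun x y =>
    ⟨fun h => (hnorm _ _).1 (by rw [he0 x h]), fun h => (hnorm _ _).2 (by rw [he0 y h])⟩
  have hF : ∀ p q : Fin 2 × Fin m, H (f p) (f q) = H2 p.1 q.1 * H' p.2 q.2 := by
    rintro ⟨b, x⟩ ⟨b', y⟩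
    have hxa : H (e x) a = 1 := by rw [hs, heS]
    fin_cases b <;> fin_cases b' <;>
      simp [hf0, hf1, hmul, hmul', ha, heS, hxa, H2, H']
  have hH' : IsHadamardMatrix H' := by
    refine ⟨fun x y => hH.1 _ _, ?_⟩
    ext x y
    have h := congrFun (congrFun hH.2 (e x)) (e y)
    simp only [Matrix.mul_apply, Matrix.transpose_apply, Matrix.smul_apply, smul_eq_mul] at h ⊢
    rw [← F.sum_comp, Fintype.sum_prod_type, Fin.sum_univ_two] at h
    have h0 : ∀ b w v, H (e w) (F (b, v)) = H' w v := fun b w v => by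
      have := hF (0, w) (b, v)
      rw [hf0] at this
      refine this.trans ?_
      fin_cases b <;> simp [H2]
    simp only [h0] at h
    have hone : (1 : Matrix (Fin n) (Fin n) ℝ) (e x) (e y) =
        (1 : Matrix (Fin m) (Fin m) ℝ) x y := by
      simp [Matrix.one_apply, Subtype.ext_iff.symm]
    rw [hone, hnm] at h
    push_cast at h
    linarith
  refine ⟨(finCongr hnm).trans (finProdFinEquiv.symm.trans F), m, hnm, H', ?_, hH', hsymm',
    hnorm', groupCond_of_row_mul hH'.1 hsymm' hnorm' ?_, ?_⟩
  · have hd : (Fin.divNat (Fin.cast hnm ⟨0, by omega⟩) : Fin 2) = 0 := by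
      apply Fin.ext
      simp [Fin.divNat]
    change f (Fin.divNat (Fin.cast hnm _), Fin.modNat (Fin.cast hnm _)) = z
    rw [hd, hf0]
    exact he0 _ (by simp [Fin.modNat])
  · intro x y
    have hxy : mul (e x) (e y) ∈ S := (hS _).2 (by rw [hmul', heS, heS, one_mul])
    exact ⟨e.symm ⟨_, hxy⟩, fun c => by simp [H', hmul]⟩
  · exact fun i j => hF _ _
end

section
/- Let H be a normalised Hadamard matrix of order n = 2^k satisfying the group condition (GC). Then there exist bijections ρ^R, ρ^C : 𝔽₂^k → [n] with ρ^R(0,…,0) = ρ^C(0,…,0) = 1 and a permutation π of [k] such that for all x, y ∈ 𝔽₂^k: H_{ρ^R(x), ρ^C(y)} = −1 if and only if ⨁_{i=1}^k x_{π(i)}·y_i = 1 (arithmetic in 𝔽₂). Moreover, if H is symmetric, then ρ^R and ρ^C can be chosen to be equal. -/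
open Matrix

/-- The family `u` has a permutation matrix as its Gram matrix with respect to `B`. -/
def HasPermGram {V ι : Type*} [AddCommGroup V] [Module (ZMod 2) V] [DecidableEq ι]
    (B : V →ₗ[ZMod 2] V →ₗ[ZMod 2] ZMod 2) (u : ι → V) (σ : Equiv.Perm ι) : Prop :=
  ∀ i j, B (u i) (u j) = if i = σ j then 1 else 0

section PermGram

variable {V ι κ : Type*} [AddCommGroup V] [Module (ZMod 2) V] [DecidableEq ι] [DecidableEq κ]
  {B : V →ₗ[ZMod 2] V →ₗ[ZMod 2] ZMod 2} {u : ι → V} {σ : Equiv.Perm ι}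

lemma HasPermGram.apply_sum [Fintype ι] (hu : HasPermGram B u σ) (x : ι → ZMod 2) (j : ι) :
    B (∑ i, x i • u i) (u j) = x (σ j) := by
  simp [map_sum, LinearMap.sum_apply, hu _ _]

lemma HasPermGram.apply_sum_sum [Fintype ι] (hu : HasPermGram B u σ) (x y : ι → ZMod 2) :
    B (∑ i, x i • u i) (∑ i, y i • u i) = ∑ i, x (σ i) * y i := by
  rw [map_sum]
  refine Finset.sum_congr rfl fun j _ => ?_
  rw [map_smul, hu.apply_sum, smul_eq_mul, mul_comm]

lemma HasPermGram.linearIndependent [Fintype ι] (hu : HasPermGram B u σ) :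
    LinearIndependent (ZMod 2) u := by
  rw [Fintype.linearIndependent_iff]
  intro g hg i
  have := hu.apply_sum g (σ.symm i)
  simpa [hg] using this.symm

lemma HasPermGram.sumElim (hu : HasPermGram B u σ) {v : κ → V} {τ : Equiv.Perm κ}
    (hv : HasPermGram B v τ) (hB : ∀ x y, B x y = B y x) (huv : ∀ i j, B (v j) (u i) = 0) :
    HasPermGram B (Sum.elim u v) (Equiv.sumCongr σ τ) := by
  rintro (i | i) (j | j)
  · simpa using hu i j
  · simpa [hB (u i)] using huv i j
  · simpa using huv j i
  · simpa using hv i j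

lemma HasPermGram.apply_sub_proj [Fintype ι] (hu : HasPermGram B u σ) (x : V) (j : ι) :
    B (x - ∑ i, B x (u (σ.symm i)) • u i) (u j) = 0 := by
  rw [map_sub, LinearMap.sub_apply, hu.apply_sum]
  simp

/-- A family with permutation Gram matrix that does not span can be enlarged to a strictly
larger one. -/
lemma HasPermGram.exists_extend {ι : Type} [DecidableEq ι] [Fintype ι] {u : ι → V}
    {σ : Equiv.Perm ι} (hu : HasPermGram B u σ)
    (hB : ∀ x y, B x y = B y x) (hnd : ∀ x, (∀ y, B x y = 0) → x = 0)
    (hspan : Submodule.span (ZMod 2) (Set.range u) ≠ ⊤) :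
    ∃ (κ : Type) (_ : Fintype κ) (_ : DecidableEq κ) (v : κ → V) (τ : Equiv.Perm κ),
      HasPermGram B v τ ∧ Fintype.card ι < Fintype.card κ := by
  have two (a : ZMod 2) (ha : a ≠ 0) : a = 1 := by revert a; decide
  by_cases hz : ∃ z, B z z = 1 ∧ ∀ i, B z (u i) = 0
  · obtain ⟨z, hzz, hzu⟩ := hz
    have hv : HasPermGram B (fun _ : Unit => z) 1 := fun i j => by simpa using hzz
    exact ⟨ι ⊕ Unit, inferInstance, inferInstance, _, _, hu.sumElim hv hB fun i _ => hzu i,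
      by simp⟩
  · have hz' (z : V) (hzu : ∀ i, B z (u i) = 0) : B z z = 0 := by
      by_contra h
      exact hz ⟨z, two _ h, hzu⟩
    obtain ⟨x, hx⟩ : ∃ x, x ∉ Submodule.span (ZMod 2) (Set.range u) := by
      by_contra! h
      exact hspan (eq_top_iff.2 fun x _ => h x)
    set z := x - ∑ i, B x (u (σ.symm i)) • u i with hzdef
    have hzu : ∀ i, B z (u i) = 0 := hu.apply_sub_proj x
    have hz0 : z ≠ 0 := by
      intro h
      rw [hzdef, sub_eq_zero] at h
      refine hx (h ▸ ?_)
      exact Submodule.sum_mem _ fun i _ =>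
        Submodule.smul_mem _ _ (Submodule.subset_span ⟨i, rfl⟩)
    obtain ⟨w, hw⟩ : ∃ w, B z w ≠ 0 := by
      by_contra! h
      exact hz0 (hnd z h)
    set w' := w - ∑ i, B w (u (σ.symm i)) • u i with hwdef
    have hwu : ∀ i, B w' (u i) = 0 := hu.apply_sub_proj w
    have hzw : B z w' = 1 := by
      rw [hwdef, map_sub, map_sum]
      simpa [hzu] using two _ hw
    have hwz : B w' z = 1 := by rw [hB, hzw]
    have hv : HasPermGram B ![z, w'] (Equiv.swap 0 1) := by
      intro i j
      fin_cases i <;> fin_cases j <;> simp [hz' z hzu, hz' w' hwu, hzw, hwz]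
    refine ⟨ι ⊕ Fin 2, inferInstance, inferInstance, _, _, hu.sumElim hv hB fun i j => ?_,
      by simp⟩
    fin_cases j
    · exact hzu i
    · exact hwu i

/-- A nondegenerate symmetric bilinear form over `𝔽₂` has a permutation matrix as its Gram matrix
in some basis. -/
lemma exists_hasPermGram_card_eq_finrank [FiniteDimensional (ZMod 2) V]
    (hB : ∀ x y, B x y = B y x) (hnd : ∀ x, (∀ y, B x y = 0) → x = 0) :
    ∃ (u : Fin (Module.finrank (ZMod 2) V) → V) (σ : Equiv.Perm _), HasPermGram B u σ := by
  have key (m : ℕ) : ∀ (ι : Type) (_ : Fintype ι) (_ : DecidableEq ι) (u : ι → V)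
      (σ : Equiv.Perm ι), HasPermGram B u σ →
      Module.finrank (ZMod 2) V ≤ Fintype.card ι + m →
      ∃ (κ : Type) (_ : Fintype κ) (_ : DecidableEq κ) (v : κ → V) (τ : Equiv.Perm κ),
        HasPermGram B v τ ∧ Fintype.card κ = Module.finrank (ZMod 2) V := by
    induction m with
    | zero =>
      intro ι _ _ u σ hu hm
      exact ⟨ι, _, _, u, σ, hu, le_antisymm hu.linearIndependent.fintype_card_le_finrank hm⟩
    | succ m ih =>
      intro ι _ _ u σ hu hm
      by_cases hspan : Submodule.span (ZMod 2) (Set.range u) = ⊤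
      · exact ⟨ι, _, _, u, σ, hu,
          (Module.finrank_eq_card_basis (Module.Basis.mk hu.linearIndependent hspan.ge)).symm⟩
      · obtain ⟨κ, _, _, v, τ, hv, hlt⟩ := hu.exists_extend hB hnd hspan
        exact ih κ _ _ v τ hv (by omega)
  obtain ⟨κ, _, _, v, τ, hv, hcard⟩ :=
    key (Module.finrank (ZMod 2) V) Empty inferInstance inferInstance Empty.elim 1
      (fun i => i.elim) (by simp)
  let e := Fintype.equivFinOfCardEq hcard
  refine ⟨v ∘ e.symm, e.symm.trans (τ.trans e), fun i j => ?_⟩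
  rw [Function.comp_apply, Function.comp_apply, hv]
  simp only [Equiv.trans_apply, Equiv.symm_apply_eq]
  congr

end PermGram

/-- A family of `2 ^ k` distinct vectors over `𝔽₂` closed under addition can be indexed linearly
by `𝔽₂ ^ k`. -/
lemma exists_equiv_linearMap {k : ℕ} {α β : Type*} [Fintype α] (hα : Fintype.card α = 2 ^ k)
    (h : α → β → ZMod 2) (hinj : Function.Injective h)
    (hadd : ∀ i j, ∃ l, h l = h i + h j) (hzero : ∃ l, h l = 0) :
    ∃ (e : (Fin k → ZMod 2) ≃ α) (f : (Fin k → ZMod 2) →ₗ[ZMod 2] (β → ZMod 2)),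
      ∀ x, h (e x) = f x := by
  let R : Submodule (ZMod 2) (β → ZMod 2) :=
    { carrier := Set.range h
      add_mem' := by
        rintro _ _ ⟨i, rfl⟩ ⟨j, rfl⟩
        exact hadd i j
      zero_mem' := hzero
      smul_mem' := by
        rintro c _ ⟨i, rfl⟩
        fin_cases c
        · obtain ⟨l, hl⟩ := hzero
          exact ⟨l, hl.trans (zero_smul (ZMod 2) (h i)).symm⟩
        · exact ⟨i, (one_smul (ZMod 2) (h i)).symm⟩ }
  let g : α ≃ R := Equiv.ofInjective h hinj
  have : Finite R := Finite.of_equiv α g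
  have hfr : Module.finrank (ZMod 2) R = k := by
    have h1 := Module.natCard_eq_pow_finrank (K := ZMod 2) (V := R)
    rw [← Nat.card_congr g, Nat.card_eq_fintype_card, hα, Nat.card_zmod] at h1
    exact (Nat.pow_right_injective le_rfl h1).symm
  let L : (Fin k → ZMod 2) ≃ₗ[ZMod 2] R := LinearEquiv.ofFinrankEq _ _ (by simp [hfr])
  refine ⟨L.toEquiv.trans g.symm, R.subtype ∘ₗ L.toLinearMap, fun x => ?_⟩
  exact congrArg Subtype.val (g.apply_symm_apply (L x))

section Hadamard

variable {n : ℕ} {H : Matrix (Fin n) (Fin n) ℝ}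

lemma IsHadamardMatrix.transpose (hH : IsHadamardMatrix H) : IsHadamardMatrix Hᵀ := by
  refine ⟨fun i j => hH.1 j i, ?_⟩
  rcases Nat.eq_zero_or_pos n with rfl | hn
  · exact Subsingleton.elim _ _
  have hn' : (n : ℝ) ≠ 0 := by positivity
  have h1 : H * ((n : ℝ)⁻¹ • Hᵀ) = 1 := by
    rw [Matrix.mul_smul, hH.2, smul_smul, inv_mul_cancel₀ hn', one_smul]
  have h2 := mul_eq_one_comm.1 h1
  rw [Matrix.smul_mul] at h2
  rw [transpose_transpose, ← h2, smul_smul, mul_inv_cancel₀ hn', one_smul]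

lemma IsHadamardMatrix.injective (hH : IsHadamardMatrix H) : Function.Injective H := by
  intro i j hij
  by_contra hne
  have h1 : (H * Hᵀ) i j = (H * Hᵀ) i i := by simp [Matrix.mul_apply, hij]
  rw [hH.2] at h1
  have : NeZero n := ⟨fun h => (h ▸ i).elim0⟩
  simp [Matrix.one_apply_ne hne, (NeZero.ne (n : ℝ)).symm] at h1

/-- The `𝔽₂`-valued matrix recording the positions of the entries `-1`. -/
noncomputable def signMatrix (H : Matrix (Fin n) (Fin n) ℝ) (i j : Fin n) : ZMod 2 :=
  if H i j = -1 then 1 else 0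

lemma signMatrix_eq_one_iff (i j : Fin n) : signMatrix H i j = 1 ↔ H i j = -1 := by
  simp [signMatrix]

lemma IsHadamardMatrix.signMatrix_injective (hH : IsHadamardMatrix H) :
    Function.Injective (signMatrix H) := by
  intro i j hij
  refine hH.injective (funext fun c => ?_)
  have hc := congrFun hij c
  rcases hH.1 i c with h1 | h1 <;> rcases hH.1 j c with h2 | h2 <;>
    simp [signMatrix, h1, h2] at hc ⊢ <;> norm_num at hc

lemma signMatrix_zero (i₀ : Fin n) (hrow : ∀ j, H i₀ j = 1) : signMatrix H i₀ = 0 := by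
  funext j
  simp only [signMatrix, hrow, Pi.zero_apply]
  norm_num

lemma IsHadamardMatrix.exists_signMatrix_add (hH : IsHadamardMatrix H) (i₀ : Fin n)
    (hrow : ∀ j, H i₀ j = 1) (hcol : ∀ i, H i i₀ = 1)
    (hG : ∀ i, rowGroup H i = rowGroup H i₀) (i j : Fin n) :
    ∃ l, signMatrix H l = signMatrix H i + signMatrix H j := by
  have hmem : H i * H j ∈ rowGroup H i₀ := hG j ▸ ⟨i, Or.inl rfl⟩
  obtain ⟨l, hl⟩ := hmem
  have hl' : ∀ c, H i c * H j c = H l c := by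
    rcases hl with hl | hl
    · intro c
      simpa [hrow] using congrFun hl c
    · have := congrFun hl i₀
      simp only [Pi.mul_apply, Pi.neg_apply, hcol] at this
      norm_num at this
  refine ⟨l, funext fun c => ?_⟩
  simp only [signMatrix, Pi.add_apply, ← hl']
  rcases hH.1 i c with h1 | h1 <;> rcases hH.1 j c with h2 | h2 <;> rw [h1, h2] <;> norm_num
  decide

/-- The rows of a normalised Hadamard matrix with the group condition on rows can be indexed
linearly by `𝔽₂ ^ k`. -/
lemma IsHadamardMatrix.exists_linear_indexing {k : ℕ} (hn : n = 2 ^ k) (hH : IsHadamardMatrix H)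
    (i₀ : Fin n) (hrow : ∀ j, H i₀ j = 1) (hcol : ∀ i, H i i₀ = 1)
    (hG : ∀ i, rowGroup H i = rowGroup H i₀) :
    ∃ (e : (Fin k → ZMod 2) ≃ Fin n) (f : (Fin k → ZMod 2) →ₗ[ZMod 2] (Fin n → ZMod 2)),
      (∀ x, signMatrix H (e x) = f x) ∧ e 0 = i₀ ∧ Function.Injective f := by
  obtain ⟨e, f, hef⟩ := exists_equiv_linearMap (by simpa using hn) (signMatrix H)
    hH.signMatrix_injective (hH.exists_signMatrix_add i₀ hrow hcol hG)
    ⟨i₀, signMatrix_zero i₀ hrow⟩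
  refine ⟨e, f, hef, hH.signMatrix_injective ?_, ?_⟩
  · rw [hef, map_zero, signMatrix_zero i₀ hrow]
  · intro x y hxy
    exact e.injective (hH.signMatrix_injective (by rw [hef, hef, hxy]))

end Hadamard

theorem stmt7 {k : ℕ} (H : Matrix (Fin (2 ^ k)) (Fin (2 ^ k)) ℝ)
    (hH : IsHadamardMatrix H) (hnorm : Normalised H) (hGC : GroupCond H) :
    ∃ (ρR ρC : (Fin k → ZMod 2) → Fin (2 ^ k)) (π : Equiv.Perm (Fin k)),
      Function.Bijective ρR ∧ Function.Bijective ρC ∧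
      ρR 0 = ⟨0, by positivity⟩ ∧ ρC 0 = ⟨0, by positivity⟩ ∧
      (∀ x y : Fin k → ZMod 2,
        H (ρR x) (ρC y) = -1 ↔ ∑ i : Fin k, x (π i) * y i = 1) ∧
      (H.IsSymm → ρR = ρC) := by
  set i₀ : Fin (2 ^ k) := ⟨0, by positivity⟩
  have hrow : ∀ j, H i₀ j = 1 := fun j => (hnorm i₀ j).1 rfl
  have hcol : ∀ i, H i i₀ = 1 := fun i => (hnorm i i₀).2 rfl
  obtain ⟨eR, fR, hR, hR0, hRinj⟩ :=
    hH.exists_linear_indexing rfl i₀ hrow hcol fun i => hGC.1 i i₀ rfl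
  by_cases hsymm : H.IsSymm
  · have hs (i j : Fin (2 ^ k)) : signMatrix H i j = signMatrix H j i := by
      simp only [signMatrix, hsymm.apply j i]
    have hf (x y : Fin k → ZMod 2) : fR x (eR y) = fR y (eR x) := by
      rw [← hR, ← hR, hs]
    let B : (Fin k → ZMod 2) →ₗ[ZMod 2] (Fin k → ZMod 2) →ₗ[ZMod 2] ZMod 2 :=
      LinearMap.mk₂ (ZMod 2) (fun x y => fR x (eR y)) (by simp) (by simp)
        (fun x y z => by simp [hf x]) (fun c x y => by simp [hf x])
    have hB (x y) : B x y = fR x (eR y) := rfl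
    obtain ⟨u, σ, hu⟩ := exists_hasPermGram_card_eq_finrank (B := B) hf fun x hx =>
      hRinj (by
        rw [map_zero]
        funext j
        simpa [hB] using hx (eR.symm j))
    generalize hm : Module.finrank (ZMod 2) (Fin k → ZMod 2) = m at u σ hu
    obtain rfl : k = m := by simpa using hm
    let L : (Fin k → ZMod 2) →ₗ[ZMod 2] (Fin k → ZMod 2) := Fintype.linearCombination (ZMod 2) u
    have hLinj : Function.Injective L := hu.linearIndependent.fintypeLinearCombination_injective
    have hLbij : Function.Bijective L := ⟨hLinj, LinearMap.injective_iff_surjective.1 hLinj⟩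
    refine ⟨eR ∘ L, eR ∘ L, σ, eR.bijective.comp hLbij, eR.bijective.comp hLbij, by simp [hR0],
      by simp [hR0], fun x y => ?_, fun _ => rfl⟩
    rw [← hu.apply_sum_sum, ← signMatrix_eq_one_iff, Function.comp_apply, hR]
    rfl
  · obtain ⟨eC, fC, hC, hC0, -⟩ :=
      hH.transpose.exists_linear_indexing rfl i₀ hcol hrow fun i => hGC.2 i i₀ rfl
    have hf (x y : Fin k → ZMod 2) : fR x (eC y) = fC y (eR x) := by
      rw [← hR, ← hC]
      rfl
    let B : (Fin k → ZMod 2) →ₗ[ZMod 2] (Fin k → ZMod 2) →ₗ[ZMod 2] ZMod 2 :=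
      LinearMap.mk₂ (ZMod 2) (fun x y => fR x (eC y)) (by simp) (by simp)
        (fun x y z => by simp [hf x]) (fun c x y => by simp [hf x])
    have hB (x y) : B x y = fR x (eC y) := rfl
    let T : (Fin k → ZMod 2) →ₗ[ZMod 2] (Fin k → ZMod 2) :=
      LinearMap.pi fun i => B.flip (Pi.single i 1)
    have hT (x y : Fin k → ZMod 2) : B x y = ∑ i, T x i * y i := by
      conv_lhs => rw [pi_eq_sum_univ' y, map_sum]
      refine Finset.sum_congr rfl fun i _ => ?_
      rw [map_smul, smul_eq_mul, mul_comm]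
      simp [T, Pi.single]
    have hTinj : Function.Injective T := by
      rw [injective_iff_map_eq_zero]
      intro x hx
      refine hRinj ?_
      rw [map_zero]
      funext j
      simpa [hB, hx] using hT x (eC.symm j)
    let E := LinearEquiv.ofInjectiveEndo T hTinj
    refine ⟨eR ∘ E.symm, eC, 1, eR.bijective.comp E.symm.bijective, eC.bijective, by simp [hR0],
      hC0, fun x y => ?_, fun h => absurd h hsymm⟩
    have hE : T (E.symm x) = x := E.apply_symm_apply x
    have := hT (E.symm x) y
    rw [hE] at this
    simp only [Equiv.Perm.one_apply]
    rw [← this, ← signMatrix_eq_one_iff, Function.comp_apply, hR, hB]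
end
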